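/- arXiv:2410.17678 — 2 statements merged into one kernel-verified Lean document; each statement's English description precedes it below -/
import Mathlib

section
/- For all integers k ≥ 1 and n ≥ 3, the k-hyperopic cop number of the cycle C_n on n vertices equals 2. -/
namespace CopsRobber

open SimpleGraph

/-- A strategy for `d` cops on vertex set `V`: initial positions, together with a move
function taking the list of observations made so far (most recent first; the observation in a
round is `some r` if the robber, located at `r`, was visible to the cops at the start of that
round, and `none` if he was invisible) and the current cop positions, and returning the cops'
new positions. -/
structure CopStrategy (V : Type) (d : ℕ) where
  init : Fin d → V
  move : List (Option V) → (Fin d → V) → Fin d → V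

/-- A strategy for the omniscient robber against `d` cops: a starting vertex chosen after
seeing the cops' initial positions, and a move function which may depend on the entire history
of the game (the list of past (cop positions, robber position) states, most recent first),
the cops' new positions, and the robber's current position. -/
structure RobberStrategy (V : Type) (d : ℕ) where
  init : (Fin d → V) → V
  move : List ((Fin d → V) × V) → (Fin d → V) → V → V

/-- A cop strategy is legal if every cop always stays put or moves along an edge of `G`. -/
def CopStrategy.Legal {V : Type} (G : SimpleGraph V) {d : ℕ} (S : CopStrategy V d) : Prop :=
  ∀ h p i, S.move h p i = p i ∨ G.Adj (p i) (S.move h p i)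

/-- A robber strategy is legal if the robber always stays put or moves along an edge of `G`. -/
def RobberStrategy.Legal {V : Type} (G : SimpleGraph V) {d : ℕ} (R : RobberStrategy V d) :
    Prop :=
  ∀ h c r, R.move h c r = r ∨ G.Adj r (R.move h c r)

open Classical in
/-- The cops' observation: the robber's position if he is visible, `none` otherwise. -/
noncomputable def observe {V : Type} {d : ℕ} (vis : (Fin d → V) → V → Prop)
    (c : Fin d → V) (r : V) : Option V :=
  if vis c r then some r else none

/-- The play of the game determined by a cop strategy and a robber strategy, with visibility
predicate `vis`: at each stage we record the current (cop positions, robber position) together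
with the list of past observations and the list of past states. In each round the cops observe
the robber (according to `vis`), move, and then the robber moves. -/
noncomputable def play {V : Type} {d : ℕ} (vis : (Fin d → V) → V → Prop)
    (S : CopStrategy V d) (R : RobberStrategy V d) :
    ℕ → ((Fin d → V) × V) × (List (Option V) × List ((Fin d → V) × V))
  | 0 => ((S.init, R.init S.init), ([], []))
  | n + 1 =>
    let st := play vis S R n
    let c := st.1.1
    let r := st.1.2
    let o := observe vis c r
    let c' := S.move (o :: st.2.1) c
    let r' := R.move ((c, r) :: st.2.2) c' r
    ((c', r'), (o :: st.2.1, (c, r) :: st.2.2))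

/-- The cops' positions at the end of round `n`. -/
noncomputable def copPos {V : Type} {d : ℕ} (vis : (Fin d → V) → V → Prop)
    (S : CopStrategy V d) (R : RobberStrategy V d) (n : ℕ) : Fin d → V :=
  (play vis S R n).1.1

/-- The robber's position at the end of round `n`. -/
noncomputable def robPos {V : Type} {d : ℕ} (vis : (Fin d → V) → V → Prop)
    (S : CopStrategy V d) (R : RobberStrategy V d) (n : ℕ) : V :=
  (play vis S R n).1.2

/-- The cops capture the robber in the given play: at some point (either at the end of a round,
or just after the cops' move within a round) some cop occupies the robber's vertex. -/
def Captures {V : Type} {d : ℕ} (vis : (Fin d → V) → V → Prop)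
    (S : CopStrategy V d) (R : RobberStrategy V d) : Prop :=
  ∃ n i, copPos vis S R n i = robPos vis S R n ∨ copPos vis S R (n + 1) i = robPos vis S R n

/-- A winning strategy for `d` cops on `G` with visibility predicate `vis`: a legal cop
strategy capturing the robber against every legal robber strategy (the robber is omniscient,
so the cops must succeed against all robber behaviours). -/
def WinningCopStrategy {V : Type} (G : SimpleGraph V) {d : ℕ}
    (vis : (Fin d → V) → V → Prop) (S : CopStrategy V d) : Prop :=
  S.Legal G ∧ ∀ R : RobberStrategy V d, R.Legal G → Captures vis S R

/-- The minimum number of cops having a winning strategy on `G`, for the game with visibility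
predicate `vis`. -/
noncomputable def copNumberVis {V : Type} (G : SimpleGraph V)
    (vis : ∀ d : ℕ, (Fin d → V) → V → Prop) : ℕ :=
  sInf {d | ∃ S : CopStrategy V d, WinningCopStrategy G (vis d) S}

/-- The classical cop number `c(G)`: the robber is always visible. -/
noncomputable def copNumber {V : Type} (G : SimpleGraph V) : ℕ :=
  copNumberVis G fun _ _ _ => True

/-- The 0-visibility cop number `c₀(G)`: the robber is never visible. -/
noncomputable def zeroVisCopNumber {V : Type} (G : SimpleGraph V) : ℕ :=
  copNumberVis G fun _ _ _ => False

/-- The `k`-hyperopic cop number `c_{H,k}(G)`: the robber at `r` is invisible exactly when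
every cop `c` satisfies `1 ≤ d(r,c) ≤ k`. -/
noncomputable def hyperopicCopNumber {V : Type} (G : SimpleGraph V) (k : ℕ) : ℕ :=
  copNumberVis G fun _ c r => ¬ ∀ i, 1 ≤ G.dist r (c i) ∧ G.dist r (c i) ≤ k

theorem cycleGraph_adj_iff_val {n : ℕ} (hn : 3 ≤ n) (u v : Fin n) :
    (cycleGraph n).Adj u v ↔ u.val + 1 = v.val ∨ v.val + 1 = u.val ∨
      (u.val = 0 ∧ v.val + 1 = n) ∨ (v.val = 0 ∧ u.val + 1 = n) := by
  have hu := u.isLt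
  have hv := v.isLt
  rw [cycleGraph_adj']
  rcases le_or_gt u v with h | h
  · rw [Fin.coe_sub_iff_le.mpr h]
    rcases h.eq_or_lt with rfl | h
    · rw [Fin.coe_sub_iff_le.mpr h]
      omega
    · have h' : u.val < v.val := h
      rw [Fin.coe_sub_iff_lt.mpr h]
      omega
  · have h' : v.val < u.val := h
    rw [Fin.coe_sub_iff_le.mpr h.le, Fin.coe_sub_iff_lt.mpr h]
    omega

/-- One cop guards vertex `0` while the other sweeps the cycle from vertex `1` upwards. -/
def sweep (n : ℕ) (hn : 3 ≤ n) : CopStrategy (Fin n) 2 where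
  init := ![⟨0, by omega⟩, ⟨1, by omega⟩]
  move _ p := ![p 0, if h : (p 1).val + 1 < n then ⟨(p 1).val + 1, h⟩ else p 1]

theorem sweep_winning {n : ℕ} (hn : 3 ≤ n) (vis : (Fin 2 → Fin n) → Fin n → Prop) :
    WinningCopStrategy (cycleGraph n) vis (sweep n hn) := by
  constructor
  · intro h p i
    fin_cases i
    · simp [sweep]
    · by_cases hp : (p 1).val + 1 < n
      · right
        rw [cycleGraph_adj_iff_val hn]
        simp [sweep, hp]
      · simp [sweep, hp]
  · intro R hR
    by_contra hcap
    have safe : ∀ t i, (copPos vis (sweep n hn) R t i).val ≠ (robPos vis (sweep n hn) R t).val ∧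
        (copPos vis (sweep n hn) R (t + 1) i).val ≠ (robPos vis (sweep n hn) R t).val := by
      intro t i
      simp only [Fin.val_ne_iff]
      exact ⟨fun h => hcap ⟨t, i, .inl h⟩, fun h => hcap ⟨t, i, .inr h⟩⟩
    have trapped : ∀ t, t + 1 < n → (copPos vis (sweep n hn) R t 0).val = 0 ∧
        (copPos vis (sweep n hn) R t 1).val = t + 1 ∧
        t + 1 < (robPos vis (sweep n hn) R t).val := by
      intro t
      induction t with
      | zero =>
        intro _
        have h0 : (copPos vis (sweep n hn) R 0 0).val = 0 := rfl
        have h1 : (copPos vis (sweep n hn) R 0 1).val = 1 := rfl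
        have s0 := (safe 0 0).1
        have s1 := (safe 0 1).1
        omega
      | succ t ih =>
        intro ht
        obtain ⟨h0, h1, hr⟩ := ih (by omega)
        have m0 : (copPos vis (sweep n hn) R (t + 1) 0).val = 0 := h0
        have m1 : (copPos vis (sweep n hn) R (t + 1) 1).val = t + 2 := by
          have hlt : (copPos vis (sweep n hn) R t 1).val + 1 < n := by omega
          exact (congrArg Fin.val (dif_pos hlt)).trans (congrArg (· + 1) h1)
        have s := (safe t 1).2
        have s0 := (safe (t + 1) 0).1
        have s1 := (safe (t + 1) 1).1
        have hm : robPos vis (sweep n hn) R (t + 1) = robPos vis (sweep n hn) R t ∨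
            (cycleGraph n).Adj (robPos vis (sweep n hn) R t)
              (robPos vis (sweep n hn) R (t + 1)) := hR _ _ _
        rw [cycleGraph_adj_iff_val hn, Fin.ext_iff] at hm
        omega
    have := trapped (n - 2) (by omega)
    omega

theorem no_cops_not_winning {V : Type} [Nonempty V] (G : SimpleGraph V)
    (vis : (Fin 0 → V) → V → Prop) (S : CopStrategy V 0) : ¬ WinningCopStrategy G vis S := by
  rintro ⟨-, h⟩
  obtain ⟨-, i, -⟩ := h ⟨fun _ => Classical.arbitrary V, fun _ _ r => r⟩ fun _ _ _ => .inl rfl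
  exact i.elim0

theorem exists_escape {n : ℕ} (hn : 4 ≤ n) (c r : Fin n) (h : c ≠ r) :
    ∃ r', (r' = r ∨ (cycleGraph n).Adj r r') ∧ c ≠ r' ∧ ¬ (cycleGraph n).Adj c r' := by
  have hc := c.isLt
  have hr := r.isLt
  simp only [cycleGraph_adj_iff_val (show 3 ≤ n by omega), Fin.ext_iff, ne_eq] at h ⊢
  by_cases h1 : c.val + 1 = r.val ∨ (r.val = 0 ∧ c.val + 1 = n)
  · by_cases h2 : r.val + 1 = n
    · exact ⟨⟨0, by omega⟩, by grind⟩
    · exact ⟨⟨r.val + 1, by omega⟩, by grind⟩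
  · by_cases h2 : r.val + 1 = c.val ∨ (c.val = 0 ∧ r.val + 1 = n)
    · by_cases h3 : r.val = 0
      · exact ⟨⟨n - 1, by omega⟩, by grind⟩
      · exact ⟨⟨r.val - 1, by omega⟩, by grind⟩
    · exact ⟨r, by grind⟩

open Classical in
theorem one_cop_not_winning_of_four_le {n : ℕ} (hn : 4 ≤ n)
    (vis : (Fin 1 → Fin n) → Fin n → Prop) (S : CopStrategy (Fin n) 1) :
    ¬ WinningCopStrategy (cycleGraph n) vis S := by
  rintro ⟨hS, hwin⟩
  have start : ∀ c : Fin n, ∃ r, c ≠ r ∧ ¬ (cycleGraph n).Adj c r := by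
    intro c
    have : Nontrivial (Fin n) := Fin.nontrivial_iff_two_le.mpr (by omega)
    obtain ⟨r, hr⟩ := exists_ne c
    obtain ⟨r', -, h⟩ := exists_escape hn c r hr.symm
    exact ⟨r', h⟩
  have step : ∀ c r : Fin n, ∃ r', (r' = r ∨ (cycleGraph n).Adj r r') ∧
      (c ≠ r → c ≠ r' ∧ ¬ (cycleGraph n).Adj c r') := by
    intro c r
    by_cases h : c = r
    · exact ⟨r, .inl rfl, fun h' => absurd h h'⟩
    · obtain ⟨r', h1, h2⟩ := exists_escape hn c r h
      exact ⟨r', h1, fun _ => h2⟩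
  choose f hf using start
  choose g hg hg' using step
  let R : RobberStrategy (Fin n) 1 := ⟨fun p => f (p 0), fun _ c r => g (c 0) r⟩
  have next : ∀ t, copPos vis S R t 0 ≠ robPos vis S R t →
      ¬ (cycleGraph n).Adj (copPos vis S R t 0) (robPos vis S R t) →
      copPos vis S R (t + 1) 0 ≠ robPos vis S R t := by
    intro t h1 h2 h
    have hm : copPos vis S R (t + 1) 0 = copPos vis S R t 0 ∨
        (cycleGraph n).Adj (copPos vis S R t 0) (copPos vis S R (t + 1) 0) := hS _ _ _
    rw [h] at hm
    exact hm.elim (fun e => h1 e.symm) h2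
  have far : ∀ t, copPos vis S R t 0 ≠ robPos vis S R t ∧
      ¬ (cycleGraph n).Adj (copPos vis S R t 0) (robPos vis S R t) := by
    intro t
    induction t with
    | zero => exact hf _
    | succ t ih => exact hg' _ _ (next t ih.1 ih.2)
  obtain ⟨t, i, h⟩ := hwin R fun _ _ _ => hg _ _
  rw [Subsingleton.elim i 0] at h
  exact h.elim (far t).1 (next t (far t).1 (far t).2)

theorem play_observations_eq_map {V : Type} {d : ℕ} (vis : (Fin d → V) → V → Prop)
    (S : CopStrategy V d) (R : RobberStrategy V d) (t : ℕ) :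
    (play vis S R t).2.1 = (play vis S R t).2.2.map fun s => observe vis s.1 s.2 := by
  induction t with
  | zero => rfl
  | succ t ih => simp only [play, List.map_cons, ih]

/-- On a complete graph with at least three vertices, a robber who is invisible whenever he is
not caught evades a single cop by avoiding both the cop and the cop's next position. -/
theorem one_cop_not_winning_top {V : Type} (hV : ∀ a b : V, ∃ r, a ≠ r ∧ b ≠ r)
    (vis : (Fin 1 → V) → V → Prop) (hvis : ∀ c r, c 0 ≠ r → ¬ vis c r)
    (S : CopStrategy V 1) : ¬ WinningCopStrategy (⊤ : SimpleGraph V) vis S := by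
  rintro ⟨-, hwin⟩
  choose f hf hf' using hV
  let R : RobberStrategy V 1 :=
    ⟨fun p => f (p 0) (S.move [none] p 0),
      fun h c _ => f (c 0) (S.move (none :: h.map fun s => observe vis s.1 s.2) c 0)⟩
  have apart : ∀ t, copPos vis S R t 0 ≠ robPos vis S R t := by
    intro t
    cases t <;> exact hf _ _
  have robPos_eq : ∀ t, robPos vis S R t = f (copPos vis S R t 0)
      (S.move (none :: (play vis S R t).2.1) (copPos vis S R t) 0) := by
    intro t
    rw [play_observations_eq_map]
    cases t <;> rfl
  have copPos_succ : ∀ t, copPos vis S R (t + 1) =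
      S.move (none :: (play vis S R t).2.1) (copPos vis S R t) := by
    intro t
    have h : observe vis (copPos vis S R t) (robPos vis S R t) = none :=
      if_neg (hvis _ _ (apart t))
    rw [← h]
    rfl
  obtain ⟨t, i, h⟩ := hwin R fun _ _ _ => by
    rw [top_adj]
    exact (eq_or_ne _ _).imp_right Ne.symm
  rw [Subsingleton.elim i 0] at h
  refine h.elim (apart t) ?_
  rw [copPos_succ, robPos_eq]
  exact hf' _ _

/-- For all integers `k ≥ 1` and `n ≥ 3`, the `k`-hyperopic cop number of the cycle `Cₙ` on
`n` vertices equals `2`. -/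
theorem stmt4 (k n : ℕ) (hk : 1 ≤ k) (hn : 3 ≤ n) :
    hyperopicCopNumber (SimpleGraph.cycleGraph n) k = 2 := by
  have : NeZero n := ⟨by omega⟩
  have two_mem : (2 : ℕ) ∈ {d | ∃ S : CopStrategy (Fin n) d, WinningCopStrategy (cycleGraph n)
      (fun c r => ¬ ∀ i, 1 ≤ (cycleGraph n).dist r (c i) ∧ (cycleGraph n).dist r (c i) ≤ k) S} :=
    ⟨sweep n hn, sweep_winning hn _⟩
  refine le_antisymm (Nat.sInf_le two_mem) (le_csInf ⟨2, two_mem⟩ ?_)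
  rintro d ⟨S, hS⟩
  by_contra! hd
  obtain rfl | rfl : d = 0 ∨ d = 1 := by omega
  · exact no_cops_not_winning _ _ S hS
  · rcases hn.eq_or_lt with rfl | hn
    · rw [cycleGraph_three_eq_top] at hS
      refine one_cop_not_winning_top (by decide) _ (fun c r h => ?_) S hS
      have : (⊤ : SimpleGraph (Fin 3)).dist r (c 0) = 1 := dist_eq_one_iff_adj.mpr h.symm
      simp [this, hk]
    · exact one_cop_not_winning_of_four_le hn _ S hS

end CopsRobber
end

section
/- Let G be a finite connected simple graph on n vertices and let k ≥ 1 be an integer. If G has a perfect matching, then c_{H,k}(G) ≤ α'(G); otherwise c_{H,k}(G) ≤ α'(G) + 1. Moreover, in both cases c_{H,k}(G) ≤ ⌈n/2⌉. -/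
namespace CopsRobber

open SimpleGraph

/-- The matching number `α'(G)`: the maximum number of edges in a matching of `G`. -/
noncomputable def matchingNumber {V : Type} (G : SimpleGraph V) : ℕ :=
  sSup {n | ∃ M : G.Subgraph, M.IsMatching ∧ M.edgeSet.ncard = n}

/-- Exchange the endpoints `a` and `b` of an edge, fixing every other vertex. -/
noncomputable def swapEnds {V : Type} (a b p : V) : V :=
  open Classical in if p = a then b else if p = b then a else p

lemma swapEnds_eq_or_adj {V : Type} {G : SimpleGraph V} {a b : V} (h : G.Adj a b) (p : V) :
    swapEnds a b p = p ∨ G.Adj p (swapEnds a b p) := by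
  unfold swapEnds
  split_ifs with h1 h2
  · exact Or.inr (h1 ▸ h)
  · exact Or.inr (h2 ▸ h.symm)
  · exact Or.inl rfl

lemma swapEnds_left {V : Type} (a b : V) : swapEnds a b a = b := by
  simp [swapEnds]

lemma swapEnds_right {V : Type} (a b : V) : swapEnds a b b = a := by
  simp +contextual [swapEnds]

lemma play_observations_length {V : Type} {d : ℕ} (vis : (Fin d → V) → V → Prop)
    (S : CopStrategy V d) (R : RobberStrategy V d) (n : ℕ) :
    (play vis S R n).2.1.length = n := by
  induction n with
  | zero => rfl
  | succ n ih => simp [play, ih]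

lemma copPos_succ {V : Type} {d : ℕ} (vis : (Fin d → V) → V → Prop)
    (S : CopStrategy V d) (R : RobberStrategy V d) (n : ℕ) :
    ∃ h : List (Option V), h.length = n + 1 ∧
      copPos vis S R (n + 1) = S.move h (copPos vis S R n) :=
  ⟨observe vis (copPos vis S R n) (robPos vis S R n) :: (play vis S R n).2.1,
    by simp [play_observations_length], rfl⟩

lemma robPos_succ_eq_or_adj {V : Type} {G : SimpleGraph V} {d : ℕ}
    (vis : (Fin d → V) → V → Prop) (S : CopStrategy V d) {R : RobberStrategy V d}
    (hR : R.Legal G) (n : ℕ) :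
    robPos vis S R (n + 1) = robPos vis S R n ∨
      G.Adj (robPos vis S R n) (robPos vis S R (n + 1)) :=
  hR _ _ _

/-- If the vertex set is covered by `d` edges, then `d` cops win, one patrolling each edge. -/
lemma exists_winning_of_edge_cover {V : Type} {G : SimpleGraph V} {d : ℕ} {a b : Fin d → V}
    (hab : ∀ i, G.Adj (a i) (b i)) (hcov : ∀ v, ∃ i, v = a i ∨ v = b i)
    (vis : (Fin d → V) → V → Prop) :
    ∃ S : CopStrategy V d, WinningCopStrategy G vis S := by
  refine ⟨⟨a, fun _ p i => swapEnds (a i) (b i) (p i)⟩,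
    fun _ p i => swapEnds_eq_or_adj (hab i) (p i), fun R _ => ?_⟩
  obtain ⟨i, hi | hi⟩ := hcov (R.init a)
  · exact ⟨0, i, Or.inl hi.symm⟩
  · exact ⟨0, i, Or.inr ((swapEnds_left _ _).trans hi.symm)⟩

/-- A finite connected graph has a walk visiting every vertex. -/
lemma exists_walk_forall_mem_support {V : Type} [Finite V] {G : SimpleGraph V}
    (hG : G.Connected) : ∃ (u v : V) (p : G.Walk u v), ∀ x, x ∈ p.support := by
  classical
  have := Fintype.ofFinite V
  obtain ⟨u⟩ := hG.nonempty
  suffices h : ∀ s : Finset V, ∃ (v : V) (p : G.Walk u v), ∀ x ∈ s, x ∈ p.support by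
    obtain ⟨v, p, hp⟩ := h Finset.univ
    exact ⟨u, v, p, fun x => hp x (Finset.mem_univ x)⟩
  intro s
  induction s using Finset.induction_on with
  | empty => exact ⟨u, .nil, by simp⟩
  | insert y s _ ih =>
    obtain ⟨v, p, hp⟩ := ih
    obtain ⟨q⟩ := hG.preconnected v y
    refine ⟨y, p.append q, fun x hx => ?_⟩
    rw [Walk.mem_support_append_iff]
    obtain rfl | hx := Finset.mem_insert.1 hx
    · exact Or.inr q.end_mem_support
    · exact Or.inl (hp x hx)

/-- If `d` edges cover all vertices outside an independent set, then `d + 1` cops win on a finite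
connected graph: one cop patrols each edge and the remaining cop searches all vertices. -/
lemma exists_winning_of_edges_of_independent {V : Type} [Finite V] {G : SimpleGraph V}
    (hG : G.Connected) {d : ℕ} {a b : Fin d → V} (hab : ∀ i, G.Adj (a i) (b i))
    (hind : ∀ u v, G.Adj u v → ∃ i, (u = a i ∨ u = b i) ∨ (v = a i ∨ v = b i))
    (vis : (Fin (d + 1) → V) → V → Prop) :
    ∃ S : CopStrategy V (d + 1), WinningCopStrategy G vis S := by
  classical
  obtain ⟨u, v, w, hw⟩ := exists_walk_forall_mem_support hG
  let S : CopStrategy V (d + 1) :=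
    { init := Fin.cons (w.getVert 0) a
      move := fun h p => Fin.cons
        (if p 0 = w.getVert (h.length - 1) then w.getVert h.length else p 0)
        (fun i => swapEnds (a i) (b i) (p i.succ)) }
  refine ⟨S, fun h p i => ?_, fun R hR => ?_⟩
  · refine Fin.cases ?_ (fun i => ?_) i
    · change (if _ then _ else _) = _ ∨ G.Adj _ (if _ then _ else _)
      split_ifs with hp
      · rw [hp]
        obtain hl | hl := Nat.eq_zero_or_pos h.length
        · simp [hl]
        · obtain ⟨m, hm⟩ := Nat.exists_eq_succ_of_ne_zero hl.ne'
          rw [hm]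
          by_cases hmw : m < w.length
          · exact Or.inr (w.adj_getVert_succ hmw)
          · left
            rw [w.getVert_of_length_le (by omega), w.getVert_of_length_le (by simp; omega)]
      · exact Or.inl rfl
    · exact swapEnds_eq_or_adj (hab i) (p i.succ)
  · by_contra hcap
    have hzero : ∀ n, copPos vis S R n 0 = w.getVert n := by
      intro n
      induction n with
      | zero => rfl
      | succ n ih =>
        obtain ⟨h, hl, hc⟩ := copPos_succ vis S R n
        rw [hc]
        change (if _ then _ else _) = _
        rw [if_pos (by rw [ih, hl]; rfl), hl]
    have hstep : ∀ n (i : Fin d), copPos vis S R (n + 1) i.succ =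
        swapEnds (a i) (b i) (copPos vis S R n i.succ) := by
      intro n i
      obtain ⟨h, hl, hc⟩ := copPos_succ vis S R n
      rw [hc]
      rfl
    have hedge : ∀ n (i : Fin d), copPos vis S R n i.succ = a i ∨
        copPos vis S R n i.succ = b i := by
      intro n i
      induction n with
      | zero => exact Or.inl rfl
      | succ n ih =>
        rw [hstep]
        obtain h | h := ih <;> simp [h, swapEnds_left, swapEnds_right]
    have havoid : ∀ n (i : Fin d), ¬ (robPos vis S R n = a i ∨ robPos vis S R n = b i) := by
      intro n i hr
      refine hcap ⟨n, i.succ, ?_⟩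
      rw [hstep]
      obtain h | h := hedge n i <;> obtain hr | hr := hr <;>
        simp [h, hr, swapEnds_left, swapEnds_right]
    have hconst : ∀ n, robPos vis S R n = robPos vis S R 0 := by
      intro n
      induction n with
      | zero => rfl
      | succ n ih =>
        obtain h | h := robPos_succ_eq_or_adj vis S hR n
        · exact h.trans ih
        · obtain ⟨i, hi | hi⟩ := hind _ _ h
          · exact absurd hi (havoid _ i)
          · exact absurd hi (havoid _ i)
    obtain ⟨n, hn, -⟩ := Walk.mem_support_iff_exists_getVert.1 (hw (robPos vis S R 0))
    exact hcap ⟨n, 0, Or.inl (by rw [hzero, hn, hconst n])⟩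

/-- The edges of a matching can be enumerated as `a i, b i` with all endpoints distinct. -/
lemma exists_enum_of_isMatching {V : Type} [Finite V] {G : SimpleGraph V} {M : G.Subgraph}
    (hM : M.IsMatching) :
    ∃ a b : Fin M.edgeSet.ncard → V, (∀ i, M.Adj (a i) (b i)) ∧
      (∀ v ∈ M.verts, ∃ i, v = a i ∨ v = b i) ∧ Function.Injective (Sum.elim a b) := by
  classical
  let e : Fin M.edgeSet.ncard ≃ M.edgeSet := (Finite.equivFin M.edgeSet).symm
  have hrep : ∀ i, ∃ x y, (e i : Sym2 V) = s(x, y) := fun i =>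
    Sym2.ind (f := fun z => ∃ x y, z = s(x, y)) (fun x y => ⟨x, y, rfl⟩) _
  choose a b hab using hrep
  have hadj : ∀ i, M.Adj (a i) (b i) := fun i => by
    rw [← Subgraph.mem_edgeSet, ← hab]
    exact (e i).2
  have heq : ∀ i j, s(a i, b i) = s(a j, b j) → i = j := fun i j h =>
    e.injective (Subtype.ext (by rw [hab, hab, h]))
  refine ⟨a, b, hadj, fun v hv => ?_, ?_⟩
  · obtain ⟨w, hw, -⟩ := hM hv
    obtain ⟨i, hi⟩ := e.surjective ⟨s(v, w), hw⟩
    have h := hab i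
    rw [hi] at h
    obtain ⟨h, -⟩ | ⟨h, -⟩ := Sym2.eq_iff.1 h
    · exact ⟨i, Or.inl h⟩
    · exact ⟨i, Or.inr h⟩
  · have huniq : ∀ {x y z}, M.Adj x y → M.Adj x z → y = z := fun hy hz =>
      (hM (M.edge_vert hy)).unique hy hz
    rintro (i | i) (j | j) h <;> simp only [Sum.elim_inl, Sum.elim_inr] at h
    · have h' := huniq (h ▸ hadj i) (hadj j)
      rw [heq i j (by rw [h, h'])]
    · have h' := huniq (h ▸ hadj i) (hadj j).symm
      have hij := heq i j (by rw [h, h', Sym2.eq_swap])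
      subst hij
      exact absurd h (hadj i).adj_sub.ne
    · have h' := huniq (h ▸ (hadj i).symm) (hadj j)
      have hij := heq i j (by rw [h, h', Sym2.eq_swap])
      subst hij
      exact absurd h (hadj i).adj_sub.ne'
    · have h' := huniq (h ▸ (hadj i).symm) (hadj j).symm
      rw [heq i j (by rw [h, h'])]

lemma two_mul_ncard_edgeSet_le_ncard_verts {V : Type} [Finite V] {G : SimpleGraph V}
    {M : G.Subgraph} (hM : M.IsMatching) : 2 * M.edgeSet.ncard ≤ M.verts.ncard := by
  obtain ⟨a, b, hab, -, hinj⟩ := exists_enum_of_isMatching hM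
  have hsub : Set.range (Sum.elim a b) ⊆ M.verts := by
    rintro _ ⟨i | i, rfl⟩
    · exact M.edge_vert (hab i)
    · exact M.edge_vert (hab i).symm
  have h := Set.ncard_le_ncard hsub (Set.toFinite _)
  rw [Set.ncard_range_of_injective hinj] at h
  simp only [Nat.card_eq_fintype_card, Fintype.card_sum, Fintype.card_fin] at h
  omega

lemma bddAbove_matching_sizes {V : Type} [Finite V] (G : SimpleGraph V) :
    BddAbove {n | ∃ M : G.Subgraph, M.IsMatching ∧ M.edgeSet.ncard = n} := by
  refine ⟨Nat.card (Sym2 V), ?_⟩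
  rintro _ ⟨M, -, rfl⟩
  exact Set.ncard_le_card _

lemma ncard_edgeSet_le_matchingNumber {V : Type} [Finite V] {G : SimpleGraph V}
    {M : G.Subgraph} (hM : M.IsMatching) : M.edgeSet.ncard ≤ matchingNumber G :=
  le_csSup (bddAbove_matching_sizes G) ⟨M, hM, rfl⟩

lemma exists_isMatching_ncard_eq_matchingNumber {V : Type} [Finite V] (G : SimpleGraph V) :
    ∃ M : G.Subgraph, M.IsMatching ∧ M.edgeSet.ncard = matchingNumber G :=
  Nat.sSup_mem (s := {n | ∃ M : G.Subgraph, M.IsMatching ∧ M.edgeSet.ncard = n})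
    ⟨_, ⊥, fun _ hv => absurd hv (by simp), rfl⟩ (bddAbove_matching_sizes G)

/-- Every edge of `G` meets every maximum matching. -/
lemma mem_verts_of_maximum_matching {V : Type} [Finite V] {G : SimpleGraph V}
    {M : G.Subgraph} (hM : M.IsMatching) (hmax : M.edgeSet.ncard = matchingNumber G)
    {u v : V} (huv : G.Adj u v) : u ∈ M.verts ∨ v ∈ M.verts := by
  by_contra! h
  have hsup : (M ⊔ G.subgraphOfAdj huv).IsMatching := by
    refine hM.sup (Subgraph.IsMatching.subgraphOfAdj huv) ?_
    rw [hM.support_eq_verts, support_subgraphOfAdj, Set.disjoint_right]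
    rintro x (rfl | rfl)
    · exact h.1
    · exact h.2
  have hle := ncard_edgeSet_le_matchingNumber hsup
  rw [Subgraph.edgeSet_sup, edgeSet_subgraphOfAdj, Set.union_singleton,
    Set.ncard_insert_of_notMem (fun he => h.1 (M.edge_vert (Subgraph.mem_edgeSet.1 he))) (Set.toFinite _)] at hle
  omega

lemma hyperopicCopNumber_le_of_isPerfectMatching {V : Type} [Finite V] {G : SimpleGraph V}
    {M : G.Subgraph} (hM : M.IsPerfectMatching) (k : ℕ) :
    hyperopicCopNumber G k ≤ M.edgeSet.ncard := by
  obtain ⟨a, b, hab, hcov, -⟩ := exists_enum_of_isMatching hM.1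
  exact Nat.sInf_le (exists_winning_of_edge_cover (fun i => (hab i).adj_sub)
    (fun v => hcov v (hM.2 v)) _)

lemma hyperopicCopNumber_le_matchingNumber_add_one {V : Type} [Finite V] {G : SimpleGraph V}
    (hG : G.Connected) (k : ℕ) : hyperopicCopNumber G k ≤ matchingNumber G + 1 := by
  obtain ⟨M, hM, hmax⟩ := exists_isMatching_ncard_eq_matchingNumber G
  obtain ⟨a, b, hab, hcov, -⟩ := exists_enum_of_isMatching hM
  rw [← hmax]
  refine Nat.sInf_le (exists_winning_of_edges_of_independent hG (fun i => (hab i).adj_sub)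
    (fun u v huv => ?_) _)
  obtain h | h := mem_verts_of_maximum_matching hM hmax huv
  · exact (hcov u h).imp fun _ => Or.inl
  · exact (hcov v h).imp fun _ => Or.inr

/-- For a finite connected simple graph `G` on `n` vertices and `k ≥ 1`: if `G` has a perfect
matching then `c_{H,k}(G) ≤ α'(G)`, otherwise `c_{H,k}(G) ≤ α'(G) + 1`; moreover
`c_{H,k}(G) ≤ ⌈n/2⌉`. -/
theorem stmt11 {V : Type} [Fintype V] (G : SimpleGraph V) (hG : G.Connected)
    (k : ℕ) (hk : 1 ≤ k) :
    ((∃ M : G.Subgraph, M.IsPerfectMatching) → hyperopicCopNumber G k ≤ matchingNumber G) ∧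
      (¬ (∃ M : G.Subgraph, M.IsPerfectMatching) →
        hyperopicCopNumber G k ≤ matchingNumber G + 1) ∧
      hyperopicCopNumber G k ≤ (Fintype.card V + 1) / 2 := by
  refine ⟨fun ⟨M, hM⟩ => (hyperopicCopNumber_le_of_isPerfectMatching hM k).trans
    (ncard_edgeSet_le_matchingNumber hM.1),
    fun _ => hyperopicCopNumber_le_matchingNumber_add_one hG k, ?_⟩
  by_cases hP : ∃ M : G.Subgraph, M.IsPerfectMatching
  · obtain ⟨M, hM⟩ := hP
    have h1 := hyperopicCopNumber_le_of_isPerfectMatching hM k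
    have h2 := two_mul_ncard_edgeSet_le_ncard_verts hM.1
    have h3 := Set.ncard_le_card M.verts
    rw [Nat.card_eq_fintype_card] at h3
    omega
  · obtain ⟨M, hM, hmax⟩ := exists_isMatching_ncard_eq_matchingNumber G
    have h1 := hyperopicCopNumber_le_matchingNumber_add_one hG k
    have h2 := two_mul_ncard_edgeSet_le_ncard_verts hM
    have h3 : M.verts.ncard < Nat.card V :=
      Set.ncard_lt_card fun h => hP ⟨M, hM, fun v => h ▸ Set.mem_univ v⟩
    rw [Nat.card_eq_fintype_card] at h3
    omega

end CopsRobber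
end
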